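/- arXiv:math/0005213 — 4 statements merged into one kernel-verified Lean document; each statement's English description precedes it below -/
import Mathlib

section
/- Lemma 2 (consecutive pairs): for every n ≥ 2, every invertible matrix A ∈ Matrix (Fin n) (Fin n) ℝ (det A ≠ 0) is a finite product of invertible matrices each of which is supported on a consecutive pair {i, i+1} (with i+1 ≤ n-1); that is, GL(n, ℝ) is already generated by the embedded subgroups GL_{i,i+1}(2) at consecutive coordinate pairs. -/
/-- `A` is supported on the pair `{i, j}`: it agrees with the identity matrix at
every entry whose row index or column index lies outside `{i, j}`. -/
def SupportedOnPair {n : ℕ} (A : Matrix (Fin n) (Fin n) ℝ) (i j : Fin n) : Prop :=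
  ∀ k l : Fin n, (k ≠ i ∧ k ≠ j) ∨ (l ≠ i ∧ l ≠ j) →
    A k l = if k = l then 1 else 0

open Matrix in
theorem transvection_commutator {m R : Type*} [Fintype m] [DecidableEq m] [CommRing R]
    {i j k : m} (hij : i ≠ j) (hjk : j ≠ k) (hik : i ≠ k) (c d : R) :
    transvection i j c * transvection j k d * transvection i j (-c) * transvection j k (-d) =
      transvection i k (c * d) := by
  simp only [transvection, mul_add, add_mul, mul_one, one_mul, single_mul_single_same,
    single_mul_single_of_ne _ _ _ _ hij.symm, single_mul_single_of_ne _ _ _ _ hjk.symm,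
    single_mul_single_of_ne _ _ _ _ hik.symm, add_zero, mul_neg, neg_mul,
    ← single_neg]
  abel

/-- The invertible matrices supported on some consecutive pair `{i, i + 1}`. -/
def consecutivePairSupported (n : ℕ) : Set (Matrix (Fin n) (Fin n) ℝ) :=
  {B | B.det ≠ 0 ∧ ∃ (i : ℕ) (hi : i + 1 < n),
    SupportedOnPair B ⟨i, Nat.lt_of_succ_lt hi⟩ ⟨i + 1, hi⟩}

theorem SupportedOnPair.symm {n : ℕ} {A : Matrix (Fin n) (Fin n) ℝ} {i j : Fin n}
    (h : SupportedOnPair A i j) : SupportedOnPair A j i :=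
  fun k l hkl => h k l (hkl.imp And.symm And.symm)

theorem supportedOnPair_transvection {n : ℕ} (i j : Fin n) (c : ℝ) :
    SupportedOnPair (Matrix.transvection i j c) i j := by
  intro k l hkl
  have : ¬(i = k ∧ j = l) := by
    rintro ⟨rfl, rfl⟩
    simp at hkl
  simp [Matrix.transvection, Matrix.one_apply, this]

theorem supportedOnPair_diagonal_mulSingle {n : ℕ} {i j k : Fin n} (hk : k = i ∨ k = j) (c : ℝ) :
    SupportedOnPair (Matrix.diagonal (Pi.mulSingle k c)) i j := by
  intro a b hab
  rw [Matrix.diagonal_apply]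
  split_ifs with h
  · subst h
    refine Pi.mulSingle_eq_of_ne (M := fun _ => ℝ) (fun h => ?_) c
    subst h
    tauto
  · rfl

theorem transvection_mem_closure_of_lt {n : ℕ} (i k : ℕ) (hik : i < k) :
    ∀ (hk : k < n) (c : ℝ),
      Matrix.transvection (⟨i, hik.trans hk⟩ : Fin n) ⟨k, hk⟩ c ∈
        Submonoid.closure (consecutivePairSupported n) ∧
      Matrix.transvection (⟨k, hk⟩ : Fin n) ⟨i, hik.trans hk⟩ c ∈
        Submonoid.closure (consecutivePairSupported n) := by
  have adjacent (j : ℕ) (hj : j + 1 < n) (c : ℝ) :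
      Matrix.transvection (⟨j, Nat.lt_of_succ_lt hj⟩ : Fin n) ⟨j + 1, hj⟩ c ∈
        Submonoid.closure (consecutivePairSupported n) ∧
      Matrix.transvection (⟨j + 1, hj⟩ : Fin n) ⟨j, Nat.lt_of_succ_lt hj⟩ c ∈
        Submonoid.closure (consecutivePairSupported n) := by
    constructor <;> refine Submonoid.subset_closure ⟨?_, j, hj, ?_⟩
    · simp [Matrix.det_transvection_of_ne]
    · exact supportedOnPair_transvection _ _ c
    · simp [Matrix.det_transvection_of_ne]
    · exact (supportedOnPair_transvection _ _ c).symm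
  induction k, hik using Nat.le_induction with
  | base => exact fun hk c => adjacent i hk c
  | succ k hik ih =>
    intro hk c
    have hk' := Nat.lt_of_succ_lt hk
    have hne₁ : (⟨i, by omega⟩ : Fin n) ≠ ⟨k, hk'⟩ := by simp; omega
    have hne₂ : (⟨k, hk'⟩ : Fin n) ≠ ⟨k + 1, hk⟩ := by simp
    have hne₃ : (⟨i, by omega⟩ : Fin n) ≠ ⟨k + 1, hk⟩ := by simp; omega
    constructor
    · rw [← mul_one c, ← transvection_commutator hne₁ hne₂ hne₃]
      exact mul_mem (mul_mem (mul_mem (ih hk' _).1 (adjacent k hk _).1) (ih hk' _).1)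
        (adjacent k hk _).1
    · rw [← mul_one c, ← transvection_commutator hne₂.symm hne₁.symm hne₃.symm]
      exact mul_mem (mul_mem (mul_mem (adjacent k hk _).2 (ih hk' _).2) (adjacent k hk _).2)
        (ih hk' _).2

theorem transvection_mem_closure {n : ℕ} {i j : Fin n} (hij : i ≠ j) (c : ℝ) :
    Matrix.transvection i j c ∈ Submonoid.closure (consecutivePairSupported n) := by
  rcases lt_or_gt_of_ne hij with h | h
  · exact (transvection_mem_closure_of_lt i j h j.2 c).1
  · exact (transvection_mem_closure_of_lt j i h i.2 c).2

theorem diagonal_mem_closure {n : ℕ} (hn : 2 ≤ n) (D : Fin n → ℝ) (hD : ∀ i, D i ≠ 0) :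
    Matrix.diagonal D ∈ Submonoid.closure (consecutivePairSupported n) := by
  suffices D ∈ (Submonoid.closure (consecutivePairSupported n)).comap
      (Matrix.diagonalRingHom (Fin n) ℝ : (Fin n → ℝ) →* Matrix (Fin n) (Fin n) ℝ) from this
  rw [← Finset.univ_prod_mulSingle D]
  refine Submonoid.prod_mem _ fun k _ => Submonoid.subset_closure ⟨?_, ?_⟩
  · change (Matrix.diagonal (Pi.mulSingle k (D k))).det ≠ 0
    rw [Matrix.det_diagonal, Finset.prod_ne_zero_iff]
    intro a _
    rcases eq_or_ne a k with rfl | h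
    · simpa using hD a
    · simp [Pi.mulSingle_eq_of_ne h]
  · by_cases hk : (k : ℕ) + 1 < n
    · exact ⟨k, hk, supportedOnPair_diagonal_mulSingle (Or.inl rfl) _⟩
    · have hk' : (k : ℕ) - 1 + 1 < n := by omega
      exact ⟨k - 1, hk', supportedOnPair_diagonal_mulSingle
        (Or.inr (Fin.ext (by simp only; omega))) _⟩


/-- Lemma 2 (consecutive pairs): for `n ≥ 2`, every invertible real matrix is a
finite product of invertible matrices each supported on a consecutive pair
`{i, i+1}`: `GL(n, ℝ)` is generated by the embedded subgroups `GL_{i,i+1}(2)`. -/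
theorem GL_generated_by_consecutivePairSupported (n : ℕ) (hn : 2 ≤ n)
    (A : Matrix (Fin n) (Fin n) ℝ) (hA : A.det ≠ 0) :
    ∃ L : List (Matrix (Fin n) (Fin n) ℝ),
      (∀ B ∈ L, B.det ≠ 0 ∧ ∃ (i : ℕ) (hi : i + 1 < n),
        SupportedOnPair B ⟨i, Nat.lt_of_succ_lt hi⟩ ⟨i + 1, hi⟩) ∧
      A = L.prod := by
  have hmem : A ∈ Submonoid.closure (consecutivePairSupported n) := by
    refine Matrix.diagonal_transvection_induction_of_det_ne_zero _ A hA (fun D hD => ?_)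
      (fun t => transvection_mem_closure t.hij t.c) (fun _ _ _ _ => mul_mem)
    rw [Matrix.det_diagonal, Finset.prod_ne_zero_iff] at hD
    exact diagonal_mem_closure hn D fun i => hD i (Finset.mem_univ i)
  obtain ⟨L, hL, hprod⟩ := Submonoid.exists_list_of_mem_closure hmem
  exact ⟨L, hL, hprod.symm⟩
end

section
/- For every n ≥ 2, every matrix A ∈ Matrix (Fin n) (Fin n) ℝ with Aᵀ * A = 1 and det A = 1 is a finite product of Givens rotations G_{i,i+1}(x) at consecutive coordinate pairs (i ranging over indices with i+1 ≤ n-1 and x over ℝ); that is, the special orthogonal group SO(n) is generated by the embedded rotation subgroups SO_{i,i+1}(2). -/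
open Matrix

/-- The Givens rotation `G_{i,j}(x)`: the identity matrix except that the entries at
`(i,i), (i,j), (j,i), (j,j)` are `cos x, sin x, -sin x, cos x` respectively. -/
noncomputable def givensRotation {n : ℕ} (i j : Fin n) (x : ℝ) : Matrix (Fin n) (Fin n) ℝ :=
  Matrix.of fun k l =>
    if k = i ∧ l = i then Real.cos x
    else if k = i ∧ l = j then Real.sin x
    else if k = j ∧ l = i then -Real.sin x
    else if k = j ∧ l = j then Real.cos x
    else if k = l then 1 else 0

theorem givensRotation_mulVec {n : ℕ} {i j : Fin n} (hij : i ≠ j) (x : ℝ) (w : Fin n → ℝ) :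
    givensRotation i j x *ᵥ w = fun k =>
      if k = i then Real.cos x * w i + Real.sin x * w j
      else if k = j then -Real.sin x * w i + Real.cos x * w j
      else w k := by
  funext k
  have row : givensRotation i j x k =
      if k = i then Pi.single i (Real.cos x) + Pi.single j (Real.sin x)
      else if k = j then Pi.single i (-Real.sin x) + Pi.single j (Real.cos x)
      else Pi.single k 1 := by
    funext l
    simp only [givensRotation, Matrix.of_apply]
    split_ifs <;> simp_all [Pi.single_apply, eq_comm]
  change givensRotation i j x k ⬝ᵥ w = _
  rw [row]
  split_ifs <;> simp [add_dotProduct]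

theorem givensRotation_mul {n : ℕ} {i j : Fin n} (hij : i ≠ j) (x y : ℝ) :
    givensRotation i j x * givensRotation i j y = givensRotation i j (x + y) := by
  refine Matrix.ext_of_mulVec_single fun l => ?_
  rw [← Matrix.mulVec_mulVec]
  simp only [givensRotation_mulVec hij, hij.symm, if_true, if_false, Real.cos_add, Real.sin_add]
  funext k
  split_ifs <;> ring

theorem givensRotation_zero {n : ℕ} {i j : Fin n} (hij : i ≠ j) :
    givensRotation i j 0 = 1 := by
  refine Matrix.ext_of_mulVec_single fun l => ?_
  rw [givensRotation_mulVec hij, Matrix.one_mulVec]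
  funext k
  split_ifs <;> simp_all

theorem givensRotation_transpose {n : ℕ} {i j : Fin n} (hij : i ≠ j) (x : ℝ) :
    (givensRotation i j x)ᵀ = givensRotation i j (-x) := by
  ext k l
  simp only [givensRotation, Matrix.transpose_apply, Matrix.of_apply, Real.cos_neg, Real.sin_neg]
  grind

theorem givensRotation_transpose_mul_self {n : ℕ} {i j : Fin n} (hij : i ≠ j) (x : ℝ) :
    (givensRotation i j x)ᵀ * givensRotation i j x = 1 := by
  rw [givensRotation_transpose hij, givensRotation_mul hij, neg_add_cancel,
    givensRotation_zero hij]

theorem det_givensRotation {n : ℕ} {i j : Fin n} (hij : i ≠ j) (x : ℝ) :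
    (givensRotation i j x).det = 1 := by
  have h := congrArg Matrix.det (givensRotation_transpose_mul_self hij (x / 2))
  rw [Matrix.det_mul, Matrix.det_transpose, Matrix.det_one] at h
  rw [← add_halves x, ← givensRotation_mul hij, Matrix.det_mul, h]

/-- Every vector of the plane can be rotated onto the nonnegative half of the second axis. -/
theorem exists_rotation_onto_second_axis (a b : ℝ) :
    ∃ x : ℝ, Real.cos x * a + Real.sin x * b = 0 ∧ 0 ≤ -Real.sin x * a + Real.cos x * b := by
  set z : ℂ := ⟨b, -a⟩
  have hb : ‖z‖ * Real.cos z.arg = b := Complex.norm_mul_cos_arg z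
  have ha : ‖z‖ * Real.sin z.arg = -a := Complex.norm_mul_sin_arg z
  have ha' : a = -(‖z‖ * Real.sin z.arg) := by rw [ha, neg_neg]
  refine ⟨z.arg, ?_, ?_⟩
  · rw [← hb, ha']
    ring
  · rw [← hb, ha']
    have := norm_nonneg z
    have h1 := Real.sin_sq_add_cos_sq z.arg
    calc (0 : ℝ) ≤ ‖z‖ * (Real.sin z.arg ^ 2 + Real.cos z.arg ^ 2) := by rw [h1, mul_one]; exact this
      _ = _ := by ring

/-- The Givens rotations at consecutive coordinate pairs. -/
def consecutiveGivens (n : ℕ) : Set (Matrix (Fin n) (Fin n) ℝ) :=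
  {B | ∃ (i : ℕ) (hi : i + 1 < n) (x : ℝ),
    B = givensRotation ⟨i, Nat.lt_of_succ_lt hi⟩ ⟨i + 1, hi⟩ x}

theorem transpose_mem_closure_consecutiveGivens {n : ℕ} {g : Matrix (Fin n) (Fin n) ℝ}
    (hg : g ∈ Submonoid.closure (consecutiveGivens n)) :
    gᵀ ∈ Submonoid.closure (consecutiveGivens n) := by
  induction hg using Submonoid.closure_induction with
  | mem B hB =>
    obtain ⟨i, hi, x, rfl⟩ := hB
    refine Submonoid.subset_closure ⟨i, hi, -x, givensRotation_transpose (by simp) x⟩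
  | one => simp
  | mul B C _ _ hB hC =>
    rw [Matrix.transpose_mul]
    exact mul_mem hC hB

theorem transpose_mul_self_and_det_of_mem_closure {n : ℕ} {g : Matrix (Fin n) (Fin n) ℝ}
    (hg : g ∈ Submonoid.closure (consecutiveGivens n)) : gᵀ * g = 1 ∧ g.det = 1 := by
  induction hg using Submonoid.closure_induction with
  | mem B hB =>
    obtain ⟨i, hi, x, rfl⟩ := hB
    exact ⟨givensRotation_transpose_mul_self (by simp) x, det_givensRotation (by simp) x⟩
  | one => simp
  | mul B C _ _ hB hC =>
    refine ⟨?_, by rw [Matrix.det_mul, hB.2, hC.2, one_mul]⟩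
    rw [Matrix.transpose_mul, Matrix.mul_assoc, ← Matrix.mul_assoc Bᵀ, hB.1, Matrix.one_mul, hC.1]

/-- An orthogonal matrix fixing a basis vector preserves the corresponding coordinate. -/
theorem mulVec_apply_of_mulVec_single {n : ℕ} {B : Matrix (Fin n) (Fin n) ℝ} (hB : Bᵀ * B = 1)
    {k : Fin n} (hk : B *ᵥ Pi.single k 1 = Pi.single k 1) (w : Fin n → ℝ) :
    (B *ᵥ w) k = w k := by
  have h : Bᵀ *ᵥ Pi.single k 1 = Pi.single k 1 := by
    rw [← hk, Matrix.mulVec_mulVec, hB, Matrix.one_mulVec, hk]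
  calc (B *ᵥ w) k = Pi.single k 1 ⬝ᵥ (B *ᵥ w) := by simp
    _ = w k := by
      rw [Matrix.dotProduct_mulVec, ← Matrix.mulVec_transpose, h]
      simp

/-- The first `m` coordinates of a vector can be annihilated by consecutive Givens rotations
which fix all basis vectors of index larger than `m`. -/
theorem exists_mem_closure_mulVec_eq_zero {n : ℕ} (v : Fin n → ℝ) (m : ℕ) (hm : m < n) :
    ∃ g ∈ Submonoid.closure (consecutiveGivens n),
      (∀ k : Fin n, (k : ℕ) < m → (g *ᵥ v) k = 0) ∧
      (∀ k : Fin n, m < (k : ℕ) → g *ᵥ Pi.single k 1 = Pi.single k 1) ∧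
      (m ≠ 0 → 0 ≤ (g *ᵥ v) ⟨m, hm⟩) := by
  induction m with
  | zero => exact ⟨1, one_mem _, by simp, fun k _ => Matrix.one_mulVec _, by simp⟩
  | succ m ih =>
    obtain ⟨g, hg, hzero, hfix, -⟩ := ih (Nat.lt_of_succ_lt hm)
    obtain ⟨x, hx0, hx1⟩ := exists_rotation_onto_second_axis
      ((g *ᵥ v) ⟨m, Nat.lt_of_succ_lt hm⟩) ((g *ᵥ v) ⟨m + 1, hm⟩)
    have hne : (⟨m, Nat.lt_of_succ_lt hm⟩ : Fin n) ≠ ⟨m + 1, hm⟩ := by simp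
    refine ⟨_, mul_mem (Submonoid.subset_closure ⟨m, hm, x, rfl⟩) hg, fun k hk => ?_,
      fun k hk => ?_, fun _ => ?_⟩
    · rw [← Matrix.mulVec_mulVec, givensRotation_mulVec hne]
      rcases Nat.lt_succ_iff_lt_or_eq.mp hk with h | h
      · have h1 : k ≠ ⟨m, Nat.lt_of_succ_lt hm⟩ := by simp [Fin.ext_iff, h.ne]
        have h2 : k ≠ ⟨m + 1, hm⟩ := by simp [Fin.ext_iff, hk.ne]
        simp only [h1, h2, if_false, hzero k h]
      · have h1 : k = ⟨m, Nat.lt_of_succ_lt hm⟩ := Fin.ext h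
        simp only [h1, if_true, hx0]
    · rw [← Matrix.mulVec_mulVec, hfix k (by omega), givensRotation_mulVec hne]
      have h1 : (⟨m, Nat.lt_of_succ_lt hm⟩ : Fin n) ≠ k := by simp [Fin.ext_iff]; omega
      have h2 : (⟨m + 1, hm⟩ : Fin n) ≠ k := by simp [Fin.ext_iff]; omega
      funext l
      split_ifs with hl hl' <;> simp_all
    · rw [← Matrix.mulVec_mulVec, givensRotation_mulVec hne]
      simpa [hne.symm] using hx1

theorem mem_closure_consecutiveGivens_of_fixes {n : ℕ} (m : ℕ) (hm : m ≤ n)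
    (A : Matrix (Fin n) (Fin n) ℝ) (hAO : Aᵀ * A = 1) (hAdet : A.det = 1)
    (hfix : ∀ k : Fin n, m ≤ (k : ℕ) → A *ᵥ Pi.single k 1 = Pi.single k 1) :
    A ∈ Submonoid.closure (consecutiveGivens n) := by
  induction m generalizing A with
  | zero =>
    have : A = 1 := Matrix.ext_of_mulVec_single fun k => by
      rw [hfix k (Nat.zero_le _), Matrix.one_mulVec]
    rw [this]
    exact one_mem _
  | succ m ih =>
    obtain ⟨g, hg, hzero, hgfix, hnonneg⟩ :=
      exists_mem_closure_mulVec_eq_zero (A *ᵥ Pi.single ⟨m, hm⟩ 1) m hm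
    obtain ⟨hgO, hgdet⟩ := transpose_mul_self_and_det_of_mem_closure hg
    rw [Matrix.mulVec_mulVec] at hzero hnonneg
    have hO : (g * A)ᵀ * (g * A) = 1 := by
      rw [Matrix.transpose_mul, Matrix.mul_assoc, ← Matrix.mul_assoc gᵀ, hgO, Matrix.one_mul, hAO]
    have hdet : (g * A).det = 1 := by rw [Matrix.det_mul, hgdet, hAdet, one_mul]
    have hfix' : ∀ k : Fin n, m < (k : ℕ) → (g * A) *ᵥ Pi.single k 1 = Pi.single k 1 :=
      fun k hk => by rw [← Matrix.mulVec_mulVec, hfix k hk, hgfix k hk]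
    have hA : A = gᵀ * (g * A) := by rw [← Matrix.mul_assoc, hgO, Matrix.one_mul]
    rw [hA]
    refine mul_mem (transpose_mem_closure_consecutiveGivens hg)
      (ih (Nat.le_of_succ_le hm) _ hO hdet fun k hk => ?_)
    generalize g * A = B at *
    rcases hk.lt_or_eq with hk | hk
    · exact hfix' k hk
    obtain rfl : k = ⟨m, hm⟩ := Fin.ext hk.symm
    set k : Fin n := ⟨m, hm⟩
    set c := (B *ᵥ Pi.single k 1) k with hc
    have hcol : B *ᵥ Pi.single k 1 = Pi.single k c := by
      funext l
      rcases lt_trichotomy (l : ℕ) m with h | h | h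
      · have : l ≠ k := Fin.ne_of_val_ne h.ne
        rw [hzero l h, Pi.single_eq_of_ne this]
      · obtain rfl : l = k := Fin.ext h
        rw [Pi.single_eq_same]
      · have : l ≠ k := Fin.ne_of_val_ne h.ne'
        rw [mulVec_apply_of_mulVec_single hO (hfix' l h), Pi.single_eq_of_ne this,
          Pi.single_eq_of_ne this]
    suffices c = 1 by rw [hcol, this]
    by_cases h0 : m = 0
    · have hdiag : B = Matrix.diagonal (Function.update 1 k c) := by
        refine Matrix.ext_of_mulVec_single fun l => ?_
        rw [Matrix.diagonal_mulVec_single, mul_one]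
        by_cases hl : l = k
        · rw [hl, hcol, Function.update_self]
        · rw [Function.update_of_ne hl, Pi.one_apply, hfix' l]
          have : (l : ℕ) ≠ m := fun h => hl (Fin.ext h)
          omega
      rw [hdiag, Matrix.det_diagonal, Finset.prod_update_of_mem (Finset.mem_univ k)] at hdet
      simpa using hdet
    · have hsq : c * c = 1 := by
        calc c * c = (B *ᵥ Pi.single k 1) ⬝ᵥ (B *ᵥ Pi.single k 1) := by rw [hcol]; simp
          _ = 1 := by
            rw [Matrix.dotProduct_mulVec, ← Matrix.mulVec_transpose, Matrix.mulVec_mulVec, hO]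
            simp
      nlinarith [hnonneg h0]

/-- For `n ≥ 2`, every special orthogonal matrix is a finite product of Givens
rotations at consecutive coordinate pairs: `SO(n)` is generated by the embedded
rotation subgroups `SO_{i,i+1}(2)`. -/
theorem SO_generated_by_consecutive_givens (n : ℕ) (hn : 2 ≤ n)
    (A : Matrix (Fin n) (Fin n) ℝ) (hAO : Aᵀ * A = 1) (hAdet : A.det = 1) :
    ∃ L : List (Matrix (Fin n) (Fin n) ℝ),
      (∀ B ∈ L, ∃ (i : ℕ) (hi : i + 1 < n) (x : ℝ),
        B = givensRotation ⟨i, Nat.lt_of_succ_lt hi⟩ ⟨i + 1, hi⟩ x) ∧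
      A = L.prod := by
  obtain ⟨L, hL, hprod⟩ := Submonoid.exists_list_of_mem_closure
    (mem_closure_consecutiveGivens_of_fixes n le_rfl A hAO hAdet
      fun k hk => absurd k.isLt hk.not_gt)
  exact ⟨L, hL, hprod.symm⟩
end

section
/- Every matrix A ∈ Matrix (Fin 2) (Fin 2) ℝ with det A = 1 is a finite product of matrices taken from the three one-parameter families !![Real.cos x, Real.sin x; -Real.sin x, Real.cos x], !![Real.cosh x, Real.sinh x; Real.sinh x, Real.cosh x], and !![Real.exp x, 0; 0, Real.exp (-x)] with x : ℝ; conversely every such generator has determinant 1. That is, SL(2, ℝ) is exactly the subgroup of GL(2, ℝ) generated by the rotation group SO(2), the hyperbolic rotation group SO(1,1), and the diagonal group ST(2). -/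
/-- A generator from one of the three one-parameter families: a rotation matrix
(`SO(2)`), a hyperbolic rotation matrix (`SO(1,1)`), or a diagonal matrix from
`ST(2)`. -/
def IsSL2Generator (B : Matrix (Fin 2) (Fin 2) ℝ) : Prop :=
  (∃ x : ℝ, B = !![Real.cos x, Real.sin x; -Real.sin x, Real.cos x]) ∨
  (∃ x : ℝ, B = !![Real.cosh x, Real.sinh x; Real.sinh x, Real.cosh x]) ∨
  (∃ x : ℝ, B = !![Real.exp x, 0; 0, Real.exp (-x)])

theorem IsSL2Generator.det_eq_one {B : Matrix (Fin 2) (Fin 2) ℝ} (hB : IsSL2Generator B) :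
    B.det = 1 := by
  rcases hB with ⟨x, rfl⟩ | ⟨x, rfl⟩ | ⟨x, rfl⟩
  · rw [Matrix.det_fin_two_of]
    linarith [Real.cos_sq_add_sin_sq x]
  · rw [Matrix.det_fin_two_of]
    linarith [Real.cosh_sq_sub_sinh_sq x]
  · simp [Matrix.det_fin_two_of, ← Real.exp_add]

theorem exists_eq_cos_and_eq_sin {a b : ℝ} (h : a ^ 2 + b ^ 2 = 1) :
    ∃ x : ℝ, a = Real.cos x ∧ b = Real.sin x := by
  have hn : ‖(⟨a, b⟩ : ℂ)‖ = 1 := by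
    rw [← sq_eq_sq₀ (norm_nonneg _) zero_le_one, Complex.sq_norm, Complex.normSq_mk]
    linarith
  refine ⟨Complex.arg ⟨a, b⟩, ?_, ?_⟩
  · simpa [hn] using (Complex.norm_mul_cos_arg ⟨a, b⟩).symm
  · simpa [hn] using (Complex.norm_mul_sin_arg ⟨a, b⟩).symm

/-- Some rotation makes the columns of a real `2 × 2` matrix orthogonal. -/
theorem exists_rotation_orthogonal_columns (a b c d : ℝ) :
    ∃ x : ℝ, (a * Real.cos x - b * Real.sin x) * (a * Real.sin x + b * Real.cos x) +
      (c * Real.cos x - d * Real.sin x) * (c * Real.sin x + d * Real.cos x) = 0 := by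
  let f : ℝ → ℝ := fun x ↦
    (a * Real.cos x - b * Real.sin x) * (a * Real.sin x + b * Real.cos x) +
      (c * Real.cos x - d * Real.sin x) * (c * Real.sin x + d * Real.cos x)
  have hf : Continuous f := by fun_prop
  have h0 : f 0 = a * b + c * d := by simp [f]
  have h1 : f (Real.pi / 2) = -(a * b + c * d) := by
    simp only [f, Real.cos_pi_div_two, Real.sin_pi_div_two]
    ring
  rcases le_total (f 0) 0 with h | h
  · exact mem_range_of_exists_le_of_exists_ge hf ⟨0, h⟩ ⟨Real.pi / 2, by linarith⟩
  · exact mem_range_of_exists_le_of_exists_ge hf ⟨Real.pi / 2, by linarith⟩ ⟨0, h⟩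

/-- A matrix of determinant `1` with orthogonal columns is a rotation times a diagonal matrix. -/
theorem exists_rotation_mul_diagonal {p q r s : ℝ} (hdet : p * s - q * r = 1)
    (horth : p * q + r * s = 0) :
    ∃ x y : ℝ, !![p, q; r, s] =
      !![Real.cos x, Real.sin x; -Real.sin x, Real.cos x] *
        !![Real.exp y, 0; 0, Real.exp (-y)] := by
  have hpos : 0 < p ^ 2 + r ^ 2 := by
    by_contra! h
    have hp : p = 0 := by nlinarith [sq_nonneg p, sq_nonneg r]
    have hr : r = 0 := by nlinarith [sq_nonneg p, sq_nonneg r]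
    simp [hp, hr] at hdet
  obtain ⟨n, hn, hn2⟩ : ∃ n : ℝ, 0 < n ∧ n ^ 2 = p ^ 2 + r ^ 2 :=
    ⟨√(p ^ 2 + r ^ 2), Real.sqrt_pos.2 hpos, Real.sq_sqrt hpos.le⟩
  have hs : s * n ^ 2 = p := by
    rw [hn2]
    linear_combination p * hdet + r * horth
  have hq : q * n ^ 2 = -r := by
    rw [hn2]
    linear_combination p * horth - r * hdet
  obtain ⟨x, hc, hsn⟩ := exists_eq_cos_and_eq_sin (a := p / n) (b := -r / n) (by
    field_simp
    linarith)
  refine ⟨x, Real.log n, ?_⟩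
  rw [← hc, ← hsn, Real.exp_neg, Real.exp_log hn, Matrix.mul_fin_two]
  ext i j
  fin_cases i <;> fin_cases j <;> simp <;> field_simp <;> linarith

/-- `SL(2, ℝ)` is exactly the subgroup generated by `SO(2)`, `SO(1,1)` and `ST(2)`:
every matrix of determinant `1` is a finite product of such generators, and every
such generator has determinant `1`. -/
theorem SL2_generated_by_SO2_SO11_ST2 :
    (∀ A : Matrix (Fin 2) (Fin 2) ℝ, A.det = 1 →
      ∃ L : List (Matrix (Fin 2) (Fin 2) ℝ),
        (∀ B ∈ L, IsSL2Generator B) ∧ A = L.prod) ∧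
    (∀ B : Matrix (Fin 2) (Fin 2) ℝ, IsSL2Generator B → B.det = 1) := by
  refine ⟨fun A hA ↦ ?_, fun B hB ↦ hB.det_eq_one⟩
  rw [Matrix.det_fin_two] at hA
  obtain ⟨z, hz⟩ := exists_rotation_orthogonal_columns (A 0 0) (A 0 1) (A 1 0) (A 1 1)
  have hz1 := Real.cos_sq_add_sin_sq z
  obtain ⟨x, y, hxy⟩ := exists_rotation_mul_diagonal
    (by linear_combination hA * (Real.cos z ^ 2 + Real.sin z ^ 2) + hz1) hz
  refine ⟨[!![Real.cos x, Real.sin x; -Real.sin x, Real.cos x],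
    !![Real.exp y, 0; 0, Real.exp (-y)],
    !![Real.cos (-z), Real.sin (-z); -Real.sin (-z), Real.cos (-z)]], ?_, ?_⟩
  · simp only [List.mem_cons, List.not_mem_nil, or_false]
    rintro B (rfl | rfl | rfl)
    · exact Or.inl ⟨x, rfl⟩
    · exact Or.inr (Or.inr ⟨y, rfl⟩)
    · exact Or.inl ⟨-z, rfl⟩
  · rw [List.prod_cons, List.prod_cons, List.prod_singleton, ← mul_assoc, ← hxy,
      Matrix.mul_fin_two, Real.cos_neg, Real.sin_neg]
    ext i j
    fin_cases i <;> fin_cases j <;> simp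
    · linear_combination -(A 0 0) * hz1
    · linear_combination -(A 0 1) * hz1
    · linear_combination -(A 1 0) * hz1
    · linear_combination -(A 1 1) * hz1
end

section
/- Every invertible matrix A ∈ Matrix (Fin 2) (Fin 2) ℝ (det A ≠ 0) is a finite product of matrices taken from the families !![Real.cos x, Real.sin x; -Real.sin x, Real.cos x], !![Real.cosh x, Real.sinh x; Real.sinh x, Real.cosh x], !![Real.exp x, 0; 0, Real.exp (-x)] (x : ℝ), the 2 × 2 signed permutation matrices, and the positive scalar matrices c • 1 with c > 0; that is, GL(2, ℝ) is generated by SO(2), SO(1,1), ST(2), P(2) and the positive scalars ℝ₊·E. -/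
/-- `A` is a signed permutation matrix: there are a permutation `σ` and signs `ε`
(each `1` or `-1`) with `A i j = ε j` if `i = σ j` and `A i j = 0` otherwise. -/
def IsSignedPermMatrix {n : ℕ} (A : Matrix (Fin n) (Fin n) ℝ) : Prop :=
  ∃ (σ : Equiv.Perm (Fin n)) (ε : Fin n → ℝ),
    (∀ j, ε j = 1 ∨ ε j = -1) ∧ ∀ i j, A i j = if i = σ j then ε j else 0

theorem Real.exists_polar (p q : ℝ) : ∃ r x : ℝ, 0 ≤ r ∧ p = r * Real.cos x ∧ q = r * Real.sin x :=
  ⟨‖(⟨p, q⟩ : ℂ)‖, Complex.arg ⟨p, q⟩, norm_nonneg _,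
    (Complex.norm_mul_cos_arg (⟨p, q⟩ : ℂ)).symm, (Complex.norm_mul_sin_arg (⟨p, q⟩ : ℂ)).symm⟩

/-- The rotation matrix of `SO(2)` with parameter `x`. -/
noncomputable def rotationMatrix (x : ℝ) : Matrix (Fin 2) (Fin 2) ℝ :=
  !![Real.cos x, Real.sin x; -Real.sin x, Real.cos x]

theorem rotationMatrix_mul_neg (x : ℝ) : rotationMatrix x * rotationMatrix (-x) = 1 := by
  have h := Real.sin_sq_add_cos_sq x
  ext i j
  fin_cases i <;> fin_cases j <;>
    simp [rotationMatrix, Matrix.mul_apply, Fin.sum_univ_two] <;> linarith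

theorem rotationMatrix_neg_mul (x : ℝ) : rotationMatrix (-x) * rotationMatrix x = 1 := by
  simpa using rotationMatrix_mul_neg (-x)

theorem det_rotationMatrix (x : ℝ) : (rotationMatrix x).det = 1 := by
  have h := Real.sin_sq_add_cos_sq x
  rw [rotationMatrix, Matrix.det_fin_two_of]
  linarith

/-- Some rotation on the right makes the columns of a `2 × 2` matrix orthogonal. -/
theorem exists_mul_rotationMatrix_orthogonal_columns (A : Matrix (Fin 2) (Fin 2) ℝ) :
    ∃ x : ℝ, (A * rotationMatrix x) 0 0 * (A * rotationMatrix x) 0 1 +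
      (A * rotationMatrix x) 1 0 * (A * rotationMatrix x) 1 1 = 0 := by
  obtain ⟨r, φ, -, hp, hq⟩ := Real.exists_polar
    ((A 0 0 ^ 2 + A 1 0 ^ 2 - A 0 1 ^ 2 - A 1 1 ^ 2) / 2) (A 0 0 * A 0 1 + A 1 0 * A 1 1)
  refine ⟨-(φ / 2), ?_⟩
  have hφ : φ = 2 * (φ / 2) := by ring
  rw [hφ, Real.cos_two_mul'] at hp
  rw [hφ, Real.sin_two_mul] at hq
  simp only [rotationMatrix, Matrix.mul_apply, Fin.sum_univ_two, Matrix.of_apply, Matrix.cons_val',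
    Matrix.cons_val_zero, Matrix.cons_val_one, Matrix.cons_val_fin_one, Real.cos_neg, Real.sin_neg]
  linear_combination (-2 * Real.sin (φ / 2) * Real.cos (φ / 2)) * hp +
    (Real.cos (φ / 2) ^ 2 - Real.sin (φ / 2) ^ 2) * hq

/-- A matrix with orthogonal columns and nonzero determinant is a rotation times a diagonal
matrix. -/
theorem exists_rotationMatrix_mul_eq_diagonal (B : Matrix (Fin 2) (Fin 2) ℝ) (hB : B.det ≠ 0)
    (h : B 0 0 * B 0 1 + B 1 0 * B 1 1 = 0) :
    ∃ y r s : ℝ, 0 < r ∧ s ≠ 0 ∧ rotationMatrix y * B = !![r, 0; 0, s] := by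
  obtain ⟨r, y, hr, h0, h1⟩ := Real.exists_polar (B 0 0) (B 1 0)
  have hr' : r ≠ 0 := by
    rintro rfl
    simp [Matrix.det_fin_two, h0, h1] at hB
  have hsc := Real.sin_sq_add_cos_sq y
  have horth : Real.cos y * B 0 1 + Real.sin y * B 1 1 = 0 := by
    rw [h0, h1] at h
    exact (mul_eq_zero.mp (by linear_combination h : r * _ = 0)).resolve_left hr'
  have key : rotationMatrix y * B = !![r, 0; 0, -Real.sin y * B 0 1 + Real.cos y * B 1 1] := by
    ext i j
    fin_cases i <;> fin_cases j <;>
      simp [rotationMatrix, Matrix.mul_apply, Fin.sum_univ_two, h0, h1]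
    · linear_combination r * hsc
    · exact horth
    · ring
  refine ⟨y, r, _, hr.lt_of_ne' hr', ?_, key⟩
  intro hs
  have hdet := congrArg Matrix.det key
  rw [Matrix.det_mul, det_rotationMatrix, hs, Matrix.det_fin_two_of] at hdet
  exact hB (by linarith)

theorem isSignedPermMatrix_diagonal {n : ℕ} (ε : Fin n → ℝ) (hε : ∀ j, ε j = 1 ∨ ε j = -1) :
    IsSignedPermMatrix (Matrix.diagonal ε) := by
  refine ⟨1, ε, hε, fun i j => ?_⟩
  by_cases hij : i = j
  · subst hij
    simp
  · simp [hij]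

/-- An invertible diagonal matrix with positive first entry is the product of a sign matrix,
a positive scalar and an element of `ST(2)`. -/
theorem exists_diagonal_eq_sign_mul_smul_mul_exp {r s : ℝ} (hr : 0 < r) (hs : s ≠ 0) :
    ∃ (P : Matrix (Fin 2) (Fin 2) ℝ) (c x : ℝ), IsSignedPermMatrix P ∧ 0 < c ∧
      !![r, 0; 0, s] = P * (c • (1 : Matrix (Fin 2) (Fin 2) ℝ)) *
        !![Real.exp x, 0; 0, Real.exp (-x)] := by
  obtain ⟨ε, hε, t, ht, rfl⟩ : ∃ ε : ℝ, (ε = 1 ∨ ε = -1) ∧ ∃ t : ℝ, 0 < t ∧ s = ε * t := by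
    rcases hs.lt_or_gt with h | h
    · exact ⟨-1, .inr rfl, -s, neg_pos.mpr h, by ring⟩
    · exact ⟨1, .inl rfl, s, h, by ring⟩
  have e1 : Real.exp ((Real.log r + Real.log t) / 2) * Real.exp ((Real.log r - Real.log t) / 2)
      = r := by
    rw [← Real.exp_add]
    ring_nf
    exact Real.exp_log hr
  have e2 : Real.exp ((Real.log r + Real.log t) / 2) * Real.exp (-((Real.log r - Real.log t) / 2))
      = t := by
    rw [← Real.exp_add]
    ring_nf
    exact Real.exp_log ht
  refine ⟨Matrix.diagonal ![1, ε], _, _, isSignedPermMatrix_diagonal _ ?_,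
    Real.exp_pos ((Real.log r + Real.log t) / 2), (?_ : _ = _ * _ *
      !![Real.exp ((Real.log r - Real.log t) / 2), 0; 0, _])⟩
  · intro j
    fin_cases j
    · exact .inl rfl
    · exact hε
  · rw [Matrix.mul_smul, mul_one, Matrix.smul_mul]
    ext i j
    fin_cases i <;> fin_cases j <;> simp [Matrix.diagonal_mul]
    · exact e1.symm
    · rw [mul_left_comm, e2]

/-- `GL(2, ℝ)` is generated by `SO(2)`, `SO(1,1)`, `ST(2)`, the signed permutation
matrices `P(2)` and the positive scalar matrices `ℝ₊·E`: every invertible `2 × 2`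
real matrix is a finite product of matrices from these families. -/
theorem GL2_generated_by_families (A : Matrix (Fin 2) (Fin 2) ℝ) (hA : A.det ≠ 0) :
    ∃ L : List (Matrix (Fin 2) (Fin 2) ℝ),
      (∀ B ∈ L,
        (∃ x : ℝ, B = !![Real.cos x, Real.sin x; -Real.sin x, Real.cos x]) ∨
        (∃ x : ℝ, B = !![Real.cosh x, Real.sinh x; Real.sinh x, Real.cosh x]) ∨
        (∃ x : ℝ, B = !![Real.exp x, 0; 0, Real.exp (-x)]) ∨
        IsSignedPermMatrix B ∨
        (∃ c : ℝ, 0 < c ∧ B = c • (1 : Matrix (Fin 2) (Fin 2) ℝ))) ∧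
      A = L.prod := by
  obtain ⟨x, hx⟩ := exists_mul_rotationMatrix_orthogonal_columns A
  obtain ⟨y, r, s, hr, hs, hD⟩ := exists_rotationMatrix_mul_eq_diagonal (A * rotationMatrix x)
    (by rwa [Matrix.det_mul, det_rotationMatrix, mul_one]) hx
  obtain ⟨P, c, t, hP, hc, hdiag⟩ := exists_diagonal_eq_sign_mul_smul_mul_exp hr hs
  refine ⟨[rotationMatrix (-y), P, c • 1, !![Real.exp t, 0; 0, Real.exp (-t)],
    rotationMatrix (-x)], ?_, ?_⟩
  · simp only [List.forall_mem_cons]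
    exact ⟨.inl ⟨_, rfl⟩, .inr (.inr (.inr (.inl hP))), .inr (.inr (.inr (.inr ⟨c, hc, rfl⟩))),
      .inr (.inr (.inl ⟨t, rfl⟩)), .inl ⟨_, rfl⟩, by simp⟩
  · calc A = (rotationMatrix (-y) * rotationMatrix y) * A *
          (rotationMatrix x * rotationMatrix (-x)) := by
            rw [rotationMatrix_neg_mul, rotationMatrix_mul_neg, one_mul, mul_one]
      _ = rotationMatrix (-y) * (rotationMatrix y * (A * rotationMatrix x)) *
          rotationMatrix (-x) := by simp only [mul_assoc]
      _ = _ := by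
        rw [hD, hdiag]
        simp only [List.prod_cons, List.prod_nil, mul_one, mul_assoc]
end
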